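/- arXiv:math/0508423 — 2 statements merged into one kernel-verified Lean document; each statement's English description precedes it below -/
import Mathlib

section
/- Let s > 3/4 be sufficiently close to 3/4, σ > 1/4, and T > 0. Then for sufficiently small ε > 0 there is a continuous embedding L^∞(0,T;H^s(ℝ²)) ∩ L²(0,T;C^σ(ℝ²)) ↪ L⁴(0,T;B^{1/2}_{4+ε,2}(ℝ²)); that is, there is a constant C with ‖u‖_{L⁴(0,T;B^{1/2}_{4+ε,2})} ≤ C ( ‖u‖_{L^∞(0,T;H^s)} + ‖u‖_{L²(0,T;C^σ)} ) for all u in the intersection. -/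
noncomputable section

open MeasureTheory Complex Real Filter Set
open scoped ENNReal NNReal FourierTransform ComplexConjugate

/-- The plane `ℝ²`, with its Euclidean structure. -/
abbrev R2 : Type := EuclideanSpace ℝ (Fin 2)

/-- Partial derivative `∂_{x_i} f` (as a pointwise defined function, via `fderiv`). -/
def pd {E : Type*} [NormedAddCommGroup E] [NormedSpace ℝ E]
    (i : Fin 2) (f : R2 → E) (x : R2) : E :=
  fderiv ℝ f x (EuclideanSpace.single i 1)

/-- Laplacian `Δf` on `ℝ²`. -/
def lap (f : R2 → ℂ) (x : R2) : ℂ := ∑ i : Fin 2, pd i (pd i f) x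

/-- The `H^s(ℝ²)` Sobolev norm, defined through the Fourier transform as
`‖(1+|ξ|²)^{s/2} 𝓕f‖_{L²}`. -/
def sobolevNorm (s : ℝ) (f : R2 → ℂ) : ℝ≥0∞ :=
  eLpNorm (fun ξ : R2 => ((1 + ‖ξ‖ ^ 2) ^ (s / 2) : ℝ) • 𝓕 f ξ) 2 volume

/-- Data for a Littlewood–Paley decomposition: a smooth compactly supported bump `φ` with
`0 ≤ φ ≤ 1`, `φ = 1` on `{|ξ| ≤ 1}` and `φ = 0` on `{|ξ| ≥ 5/4}`. -/
structure LPBump where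
  φ : R2 → ℝ
  smooth : ContDiff ℝ (⊤ : ℕ∞) φ
  compSupp : HasCompactSupport φ
  nonneg : ∀ ξ, 0 ≤ φ ξ
  le_one : ∀ ξ, φ ξ ≤ 1
  eq_one : ∀ ξ, ‖ξ‖ ≤ 1 → φ ξ = 1
  eq_zero : ∀ ξ, (5 : ℝ) / 4 ≤ ‖ξ‖ → φ ξ = 0

/-- The Littlewood–Paley symbols: `φ_0 = φ`, `φ_j(ξ) = φ(2^{-j}ξ) - φ(2^{-j+1}ξ)` for `j ≥ 1`. -/
def LPBump.symb (D : LPBump) : ℕ → R2 → ℝ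
  | 0, ξ => D.φ ξ
  | (j + 1), ξ => D.φ ((2 : ℝ) ^ (-(j + 1 : ℤ)) • ξ) - D.φ ((2 : ℝ) ^ (-(j + 1 : ℤ) + 1) • ξ)

/-- The Littlewood–Paley piece `S^j f`, the Fourier multiplier with symbol `φ_j`. -/
def LPBump.proj (D : LPBump) (j : ℕ) (f : R2 → ℂ) : R2 → ℂ :=
  fun x => 𝓕⁻ (fun ξ => (D.symb j ξ : ℂ) * 𝓕 f ξ) x

/-- The `ℓ^q` norm of a sequence of extended nonnegative reals, `1 ≤ q ≤ ∞`. -/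
def lqNorm (q : ℝ≥0∞) (a : ℕ → ℝ≥0∞) : ℝ≥0∞ :=
  if q = ∞ then ⨆ j, a j else (∑' j, a j ^ q.toReal) ^ (1 / q.toReal)

/-- The Besov `B^s_{p,q}(ℝ²)` norm: `‖ (2^{sj} ‖S^j f‖_{L^p})_j ‖_{ℓ^q}`. -/
def besovNorm (D : LPBump) (s : ℝ) (p q : ℝ≥0∞) (f : R2 → ℂ) : ℝ≥0∞ :=
  lqNorm q (fun j => ENNReal.ofReal ((2 : ℝ) ^ (s * (j : ℝ))) * eLpNorm (D.proj j f) p volume)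

/-- The `L^p(0,T;X)` norm of a function of time, given its time-dependent `X`-norm `N`. -/
def lpTimeNorm (p : ℝ≥0∞) (T : ℝ) (N : ℝ → ℝ≥0∞) : ℝ≥0∞ :=
  if p = ∞ then essSup N (volume.restrict (Ioo (0 : ℝ) T))
  else (∫⁻ t in Ioo (0 : ℝ) T, N t ^ p.toReal) ^ (1 / p.toReal)

/-- The kernels `G₁(x) = x₂/(2π|x|²)` and `G₂(x) = -x₁/(2π|x|²)`. -/
def Gker (i : Fin 2) (x : R2) : ℝ :=
  if i = 0 then x 1 / (2 * π * ‖x‖ ^ 2) else -(x 0) / (2 * π * ‖x‖ ^ 2)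

/-- The components `A_i[f,g] = 2 G_i ∗ Im(f₁ḡ₂ + g₁f̄₂)` of the vector field `A[f,g]`. -/
def Acomp (i : Fin 2) (f g : Fin 2 → R2 → ℂ) (x : R2) : ℝ :=
  2 * ∫ y : R2, Gker i (x - y) * (f 0 y * conj (g 1 y) + g 0 y * conj (f 1 y)).im

/-- The Riesz transform `R_i`, the Fourier multiplier with symbol `iξ_i/|ξ|`. -/
def riesz (i : Fin 2) (f : R2 → ℂ) : R2 → ℂ :=
  fun x => 𝓕⁻ (fun ξ => I * (ξ i : ℝ) / (‖ξ‖ : ℝ) * 𝓕 f ξ) x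

/-- `A₀[f,g] = 2 Σ_{j,k} R_jR_k Re(f_jḡ_k + g_jf̄_k) + 2 Re(f₁ḡ₁ + ḡ₂f₂)`. -/
def A0 (f g : Fin 2 → R2 → ℂ) (x : R2) : ℂ :=
  2 * ∑ j : Fin 2, ∑ k : Fin 2,
      riesz j (riesz k (fun y => ((f j y * conj (g k y) + g j y * conj (f k y)).re : ℂ))) x
    + 2 * ((f 0 x * conj (g 0 x) + conj (g 1 x) * f 1 x).re : ℂ)

/-- `H^s` norm of a `ℂ²`-valued map (sum of componentwise norms). -/
def vSobolev (s : ℝ) (f : Fin 2 → R2 → ℂ) : ℝ≥0∞ := ∑ m : Fin 2, sobolevNorm s (f m)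

/-- Besov norm of a `ℂ²`-valued map (sum of componentwise norms). -/
def vBesov (D : LPBump) (s : ℝ) (p q : ℝ≥0∞) (f : Fin 2 → R2 → ℂ) : ℝ≥0∞ :=
  ∑ m : Fin 2, besovNorm D s p q (f m)

/-- `L²` norm of a `ℂ²`-valued map (sum of componentwise norms). -/
def vL2 (f : Fin 2 → R2 → ℂ) : ℝ≥0∞ := ∑ m : Fin 2, eLpNorm (f m) 2 volume

/-- `u = (u₁,u₂)` is a solution, in the sense of distributions on `(0,T) × ℝ²`, of the modified
Schrödinger map system
`i∂_t u_m + Δu_m = -2i A·∇u_m + A₀ u_m + |A|² u_m + 4i Im(u_{m'} ū_m) u_{m'}`,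
with `A = A[u,u]`, `A₀ = A₀[u,u]`; the divergence-free drift term is rewritten using
`∫ (A·∇u_m)ψ = -∫ u_m (A·∇ψ)`. -/
def IsMSMSolution (T : ℝ) (u : Fin 2 → ℝ → R2 → ℂ) : Prop :=
  ∀ (m : Fin 2) (ψ : ℝ → R2 → ℂ),
    ContDiff ℝ (⊤ : ℕ∞) (fun p : ℝ × R2 => ψ p.1 p.2) →
    HasCompactSupport (fun p : ℝ × R2 => ψ p.1 p.2) →
    (∀ t, t ∉ Ioo (0 : ℝ) T → ψ t = 0) →
    (∫ t : ℝ, ∫ x : R2, u m t x * (-(I * deriv (fun τ => ψ τ x) t) + lap (ψ t) x))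
      = ∫ t : ℝ, ∫ x : R2,
          2 * I * u m t x *
              (∑ i : Fin 2, (Acomp i (fun k => u k t) (fun k => u k t) x : ℂ) * pd i (ψ t) x)
          + (A0 (fun k => u k t) (fun k => u k t) x
              + ∑ i : Fin 2, ((Acomp i (fun k => u k t) (fun k => u k t) x : ℂ)) ^ 2)
            * u m t x * ψ t x
          + 4 * I * (((u (m + 1) t x * conj (u m t x)).im : ℂ)) * u (m + 1) t x * ψ t x

/-- `u ∈ C([0,T];H^s(ℝ²))`: finite `H^s` norm and norm-continuity in time. -/
def ContHs (s T : ℝ) (u : Fin 2 → ℝ → R2 → ℂ) : Prop :=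
  ∀ m : Fin 2,
    (∀ t ∈ Icc (0 : ℝ) T, sobolevNorm s (u m t) < ∞) ∧
    ∀ t ∈ Icc (0 : ℝ) T,
      Tendsto (fun τ => sobolevNorm s (fun x => u m τ x - u m t x))
        (nhdsWithin t (Icc (0 : ℝ) T)) (nhds 0)

/-- `u ∈ L²(0,T;C^σ(ℝ²))`, where `C^σ = B^σ_{∞,∞}` is the Hölder space. -/
def L2Holder (D : LPBump) (σ T : ℝ) (u : Fin 2 → ℝ → R2 → ℂ) : Prop :=
  ∀ m : Fin 2, lpTimeNorm 2 T (fun t => besovNorm D σ ∞ ∞ (u m t)) < ∞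

/-- Extended-real exponential function. -/
def eexp (x : ℝ≥0∞) : ℝ≥0∞ := if x = ∞ then ∞ else ENNReal.ofReal (Real.exp x.toReal)

/-- Pointwise Hilbert–Schmidt norm of the Jacobian of a vector field on `ℝ²`. -/
def jacHS (v : R2 → Fin 2 → ℝ) (x : R2) : ℝ :=
  Real.sqrt (∑ i : Fin 2, ∑ j : Fin 2, (pd j (fun y => v y i) x) ^ 2)

/-- `‖∇v‖_{L^∞}`: sup of the Hilbert–Schmidt norm of the Jacobian. -/
def gradSup (v : R2 → Fin 2 → ℝ) : ℝ≥0∞ := ⨆ x : R2, ENNReal.ofReal (jacHS v x)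


/-- Plancherel's theorem for functions in `L¹ ∩ L²`, for the integral Fourier transform. -/
theorem eLpNorm_fourier_eq {g : R2 → ℂ} (hg1 : Integrable g) (hg2 : MemLp g 2 volume) :
    eLpNorm (𝓕 g) 2 volume = eLpNorm g 2 volume := by
  have hcont : Continuous (𝓕 g) :=
    VectorFourier.fourierIntegral_continuous Real.continuous_fourierChar continuous_inner hg1
  set G : Lp ℂ 2 (volume : Measure R2) := hg2.toLp g with hG
  have hae : ∀ᵐ x ∂volume, (𝓕 G : Lp ℂ 2 (volume : Measure R2)) x = 𝓕 g x := by
    refine ae_eq_of_integral_contDiff_smul_eq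
      (((Lp.memLp (𝓕 G)).locallyIntegrable (by norm_num))) hcont.locallyIntegrable ?_
    intro ψ hψ hψc
    have hψc' : HasCompactSupport (fun x => (ψ x : ℂ)) := 
      hψc.comp_left (g := fun r : ℝ => (r : ℂ)) Complex.ofReal_zero
    have hψ' : ContDiff ℝ (⊤ : ℕ∞) (fun x => (ψ x : ℂ)) := Complex.ofRealCLM.contDiff.comp hψ
    set Ψ : SchwartzMap R2 ℂ := hψc'.toSchwartzMap hψ' with hΨ
    have hΨx : ∀ x, Ψ x = (ψ x : ℂ) := fun x => by simp [hΨ]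
    have h1 := congrArg (fun d => d Ψ) (Lp.fourier_toTemperedDistribution_eq G)
    simp only [TemperedDistribution.fourier_apply, Lp.toTemperedDistribution_apply] at h1
    have h2 : ∫ x, (𝓕 Ψ) x • G x = ∫ x, (𝓕 (Ψ : R2 → ℂ)) x • g x := by
      apply integral_congr_ae
      filter_upwards [hg2.coeFn_toLp] with x hx
      rw [hG, hx, SchwartzMap.fourier_coe]
    have h3 : ∫ x, (𝓕 (Ψ : R2 → ℂ)) x • g x = ∫ x, Ψ x • (𝓕 g) x := by
      simpa using! VectorFourier.integral_fourierIntegral_smul_eq_flip (L := innerₗ R2)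
        Real.continuous_fourierChar continuous_inner Ψ.integrable hg1
    rw [h2, h3] at h1
    simp only [hΨx] at h1
    simpa using h1.symm
  rw [← eLpNorm_congr_ae hae]
  have h := Lp.norm_fourier_eq G
  rw [Lp.norm_def, Lp.norm_def,
    ENNReal.toReal_eq_toReal_iff' (Lp.eLpNorm_ne_top _) (Lp.eLpNorm_ne_top _)] at h
  rw [h, eLpNorm_congr_ae hg2.coeFn_toLp]

theorem eLpNorm_fourierInv_eq {g : R2 → ℂ} (hg1 : Integrable g) (hg2 : MemLp g 2 volume) :
    eLpNorm (𝓕⁻ g) 2 volume = eLpNorm g 2 volume := by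
  have hneg : MeasurePreserving (fun x : R2 => -x) volume volume :=
    Measure.measurePreserving_neg volume
  have h : 𝓕⁻ g = 𝓕 g ∘ fun x => -x := by
    ext x
    exact Real.fourierInv_eq_fourier_neg g x
  have hcont : Continuous (𝓕 g) :=
    VectorFourier.fourierIntegral_continuous Real.continuous_fourierChar continuous_inner hg1
  rw [h, eLpNorm_comp_measurePreserving hcont.aestronglyMeasurable hneg,
    eLpNorm_fourier_eq hg1 hg2]

theorem eLpNorm_top_fourierInv_le (g : R2 → ℂ) :
    eLpNorm (𝓕⁻ g) ∞ volume ≤ eLpNorm g 1 volume := by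
  rw [eLpNorm_exponent_top]
  refine eLpNormEssSup_le_of_ae_enorm_bound (Eventually.of_forall fun x => ?_)
  rw [Real.fourierInv_eq, eLpNorm_one_eq_lintegral_enorm]
  refine (enorm_integral_le_lintegral_enorm _).trans (le_of_eq ?_)
  refine lintegral_congr fun y => ?_
  rw [← ofReal_norm, Circle.norm_smul, ofReal_norm]

/-- Log-convexity of `L^p` norms between `L²` and `L^∞`. -/
theorem eLpNorm_le_two_top {g : R2 → ℂ} {p : ℝ} (hp : 2 < p)
    (hT : eLpNorm g ∞ volume ≠ ∞) :
    eLpNorm g (ENNReal.ofReal p) volume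
      ≤ eLpNorm g 2 volume ^ (2 / p) * eLpNorm g ∞ volume ^ (1 - 2 / p) := by
  have hp0 : 0 < p := by linarith
  rw [eLpNorm_eq_lintegral_rpow_enorm_toReal (by simpa using hp0) ENNReal.ofReal_ne_top,
    eLpNorm_eq_lintegral_rpow_enorm_toReal (by norm_num) (by norm_num),
    ENNReal.toReal_ofReal hp0.le, ENNReal.toReal_ofNat, ← ENNReal.rpow_mul]
  set N := eLpNorm g ∞ volume
  have hN : ∀ᵐ x, ‖g x‖ₑ ≤ N := by
    simpa [N, eLpNorm_exponent_top] using ae_le_eLpNormEssSup (f := g) (μ := volume)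
  have h1 : (∫⁻ x, ‖g x‖ₑ ^ p) ≤ N ^ (p - 2) * ∫⁻ x, ‖g x‖ₑ ^ (2:ℝ) := by
    rw [← lintegral_const_mul' _ _ (ENNReal.rpow_ne_top_of_nonneg (by linarith) hT)]
    refine lintegral_mono_ae (hN.mono fun x hx => ?_)
    calc ‖g x‖ₑ ^ p = ‖g x‖ₑ ^ (p - 2) * ‖g x‖ₑ ^ (2:ℝ) := by
          rw [← ENNReal.rpow_add_of_nonneg _ _ (by linarith) (by norm_num)]; ring_nf
      _ ≤ _ := by gcongr
  calc _ ≤ (N ^ (p - 2) * ∫⁻ x, ‖g x‖ₑ ^ (2:ℝ)) ^ (1 / p) := by gcongr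
    _ = _ := by
      rw [ENNReal.mul_rpow_of_nonneg _ _ (by positivity), ← ENNReal.rpow_mul, mul_comm]
      congr 2 <;> field_simp

theorem continuous_fourier_function (f : R2 → ℂ) : Continuous (𝓕 f) := by
  by_cases hf : Integrable f
  · exact VectorFourier.fourierIntegral_continuous Real.continuous_fourierChar continuous_inner hf
  · have h0 : 𝓕 f = fun _ => 0 := by
      ext ξ
      rw [Real.fourier_eq]
      refine integral_undef fun h => hf ?_
      exact (VectorFourier.fourierIntegral_convergent_iff (L := innerₗ R2)
        Real.continuous_fourierChar continuous_inner ξ).1 h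
    rw [h0]
    exact continuous_const

theorem ofReal_two_rpow (y : ℝ) : ENNReal.ofReal ((2 : ℝ) ^ y) = (2 : ℝ≥0∞) ^ y := by
  rw [← ENNReal.ofReal_rpow_of_pos (by norm_num), ENNReal.ofReal_ofNat]

namespace LPBump

variable (D : LPBump)

theorem symb_succ (j : ℕ) (ξ : R2) :
    D.symb (j + 1) ξ = D.φ (((2 : ℝ) ^ (j + 1))⁻¹ • ξ) - D.φ (((2 : ℝ) ^ j)⁻¹ • ξ) := by
  change D.φ _ - D.φ _ = _
  rw [show (-(j + 1 : ℤ) + 1) = -(j : ℤ) by ring, zpow_neg, zpow_neg, zpow_natCast]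
  norm_cast

theorem continuous_symb (j : ℕ) : Continuous (D.symb j) := by
  have h := D.smooth.continuous
  cases j with
  | zero => exact h
  | succ j =>
    rw [show D.symb (j + 1) = _ from funext (D.symb_succ j)]
    fun_prop

theorem abs_symb_le_one (j : ℕ) (ξ : R2) : |D.symb j ξ| ≤ 1 := by
  cases j with
  | zero =>
    change |D.φ ξ| ≤ 1
    rw [abs_of_nonneg (D.nonneg ξ)]
    exact D.le_one ξ
  | succ j => exact abs_sub_le_of_nonneg_of_le (D.nonneg _) (D.le_one _) (D.nonneg _) (D.le_one _)

theorem norm_inv_two_pow_smul (j : ℕ) (ξ : R2) : ‖((2 : ℝ) ^ j)⁻¹ • ξ‖ = ‖ξ‖ / 2 ^ j := by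
  rw [norm_smul, norm_inv, norm_pow, Real.norm_ofNat, div_eq_inv_mul]

theorem symb_eq_zero_of_le (j : ℕ) {ξ : R2} (h : 5 / 4 * (2 : ℝ) ^ j ≤ ‖ξ‖) :
    D.symb j ξ = 0 := by
  cases j with
  | zero => exact D.eq_zero ξ (by simpa using h)
  | succ j =>
    have hj : (0 : ℝ) < 2 ^ j := by positivity
    rw [symb_succ, D.eq_zero, D.eq_zero, sub_zero]
    · rw [norm_inv_two_pow_smul, le_div_iff₀ hj]
      rw [pow_succ] at h
      linarith
    · rwa [norm_inv_two_pow_smul, le_div_iff₀ (by positivity)]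

theorem symb_succ_eq_zero_of_le (j : ℕ) {ξ : R2} (h : ‖ξ‖ ≤ (2 : ℝ) ^ j) :
    D.symb (j + 1) ξ = 0 := by
  have hj : (0 : ℝ) < 2 ^ j := by positivity
  rw [symb_succ, D.eq_one, D.eq_one, sub_self]
  · rwa [norm_inv_two_pow_smul, div_le_iff₀ hj, one_mul]
  · rw [norm_inv_two_pow_smul, div_le_iff₀ (by positivity), pow_succ]
    linarith

/-- On the support of `φ_j`, the Sobolev weight dominates `2^{sj}` up to a constant. -/
theorem abs_symb_le_weight {s : ℝ} (hs : 0 ≤ s) (j : ℕ) (ξ : R2) :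
    |D.symb j ξ| ≤ (2 : ℝ) ^ (s - s * j) * (1 + ‖ξ‖ ^ 2) ^ (s / 2) := by
  have hw : 1 ≤ (1 + ‖ξ‖ ^ 2) ^ (s / 2) := 
    Real.one_le_rpow (by nlinarith [sq_nonneg ‖ξ‖]) (by positivity)
  cases j with
  | zero =>
    refine (D.abs_symb_le_one 0 ξ).trans ?_
    have : (1 : ℝ) ≤ 2 ^ (s - s * (0 : ℕ)) := Real.one_le_rpow (by norm_num) (by simpa using hs)
    exact one_le_mul_of_one_le_of_one_le this hw
  | succ j =>
    rcases le_or_gt ‖ξ‖ ((2 : ℝ) ^ j) with h | h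
    · rw [D.symb_succ_eq_zero_of_le j h, abs_zero]
      positivity
    · refine (D.abs_symb_le_one _ ξ).trans ?_
      have h1 : ((2 : ℝ) ^ j) ^ s ≤ (1 + ‖ξ‖ ^ 2) ^ (s / 2) := by
        have : ((2 : ℝ) ^ j) ^ s = (((2 : ℝ) ^ j) ^ 2) ^ (s / 2) := by
          rw [← Real.rpow_natCast _ 2, ← Real.rpow_mul (by positivity)]
          congr 1
          push_cast
          ring
        rw [this]
        refine Real.rpow_le_rpow (by positivity) ?_ (by positivity)
        have := pow_le_pow_left₀ (by positivity) h.le 2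
        linarith
      have h2 : (2 : ℝ) ^ (s - s * (j + 1 : ℕ)) * ((2 : ℝ) ^ j) ^ s = 1 := by
        rw [← Real.rpow_natCast, ← Real.rpow_mul (by norm_num), ← Real.rpow_add (by norm_num)]
        convert Real.rpow_zero 2 using 2
        push_cast
        ring
      exact h2.symm.le.trans (mul_le_mul_of_nonneg_left h1 (by positivity))

/-- The frequency side of `S^j f`. -/
def freq (j : ℕ) (f : R2 → ℂ) (ξ : R2) : ℂ := (D.symb j ξ : ℂ) * 𝓕 f ξ

theorem proj_eq (j : ℕ) (f : R2 → ℂ) : D.proj j f = 𝓕⁻ (D.freq j f) := rfl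

theorem continuous_freq (j : ℕ) (f : R2 → ℂ) : Continuous (D.freq j f) :=
  (Complex.continuous_ofReal.comp (D.continuous_symb j)).mul (continuous_fourier_function f)

theorem freq_eq_zero (j : ℕ) (f : R2 → ℂ) {ξ : R2} (h : 5 / 4 * (2 : ℝ) ^ j ≤ ‖ξ‖) :
    D.freq j f ξ = 0 := by
  simp [freq, D.symb_eq_zero_of_le j h]

theorem support_freq_subset (j : ℕ) (f : R2 → ℂ) :
    Function.support (D.freq j f) ⊆ Metric.closedBall 0 (5 / 4 * (2 : ℝ) ^ j) := by
  intro ξ hξ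
  rw [mem_closedBall_zero_iff]
  by_contra! h
  exact hξ (D.freq_eq_zero j f h.le)

theorem hasCompactSupport_freq (j : ℕ) (f : R2 → ℂ) : HasCompactSupport (D.freq j f) :=
  HasCompactSupport.of_support_subset_isCompact (isCompact_closedBall _ _)
    (D.support_freq_subset j f)

theorem eLpNorm_freq_two_le {s : ℝ} (hs : 0 ≤ s) (j : ℕ) (f : R2 → ℂ) :
    eLpNorm (D.freq j f) 2 volume ≤ (2 : ℝ≥0∞) ^ (s - s * j) * sobolevNorm s f := by
  rw [← ofReal_two_rpow]
  refine eLpNorm_le_mul_eLpNorm_of_ae_le_mul (Eventually.of_forall fun ξ => ?_) 2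
  rw [freq, norm_mul, norm_smul, Complex.norm_real, ← mul_assoc]
  gcongr
  rw [Real.norm_eq_abs, Real.norm_of_nonneg (by positivity)]
  exact D.abs_symb_le_weight hs j ξ

theorem eLpNorm_freq_one_le (j : ℕ) (f : R2 → ℂ) :
    eLpNorm (D.freq j f) 1 volume ≤ 3 * (2 : ℝ≥0∞) ^ (j : ℝ) * eLpNorm (D.freq j f) 2 volume := by
  set B := Metric.closedBall (0 : R2) (5 / 4 * (2 : ℝ) ^ j)
  have hvol : (volume B) ^ ((1 : ℝ) / 2) ≤ 3 * (2 : ℝ≥0∞) ^ (j : ℝ) := by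
    have h : volume B ≤ (3 * (2 : ℝ≥0∞) ^ (j : ℝ)) ^ (2 : ℝ) := by
      rw [EuclideanSpace.volume_closedBall_fin_two, ← ofReal_two_rpow, ← ENNReal.ofReal_ofNat 3,
        ← ENNReal.ofReal_mul (by norm_num), ENNReal.ofReal_rpow_of_pos (by positivity),
        ← ENNReal.ofReal_pow (by positivity), ← ENNReal.ofReal_mul (by positivity)]
      refine ENNReal.ofReal_le_ofReal ?_
      rw [Real.rpow_natCast, Real.rpow_ofNat, mul_pow, mul_pow]
      have := Real.pi_le_four
      have h2 : (0 : ℝ) < (2 ^ j) ^ 2 := by positivity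
      norm_num
      nlinarith
    calc _ ≤ ((3 * (2 : ℝ≥0∞) ^ (j : ℝ)) ^ (2 : ℝ)) ^ ((1 : ℝ) / 2) := by gcongr
      _ = _ := by rw [← ENNReal.rpow_mul]; norm_num
  calc eLpNorm (D.freq j f) 1 volume
      = eLpNorm (D.freq j f) 1 (volume.restrict B) :=
        (eLpNorm_restrict_eq_of_support_subset (D.support_freq_subset j f)).symm
    _ ≤ eLpNorm (D.freq j f) 2 (volume.restrict B) * (volume.restrict B) univ ^
          (1 / (1 : ℝ≥0∞).toReal - 1 / (2 : ℝ≥0∞).toReal) :=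
        eLpNorm_le_eLpNorm_mul_rpow_measure_univ (by norm_num)
          (D.continuous_freq j f).aestronglyMeasurable
    _ ≤ 3 * (2 : ℝ≥0∞) ^ (j : ℝ) * eLpNorm (D.freq j f) 2 volume := by
        rw [eLpNorm_restrict_eq_of_support_subset (D.support_freq_subset j f),
          Measure.restrict_apply_univ, mul_comm]
        gcongr
        refine (le_of_eq ?_).trans hvol
        congr 1
        norm_num

theorem eLpNorm_proj_two_le {s : ℝ} (hs : 0 ≤ s) (j : ℕ) (f : R2 → ℂ) :
    eLpNorm (D.proj j f) 2 volume ≤ (2 : ℝ≥0∞) ^ (s - s * j) * sobolevNorm s f := by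
  have hc := D.continuous_freq j f
  have hs' := D.hasCompactSupport_freq j f
  rw [proj_eq, eLpNorm_fourierInv_eq (hc.integrable_of_hasCompactSupport hs')
    (hc.memLp_of_hasCompactSupport hs')]
  exact D.eLpNorm_freq_two_le hs j f

/-- Bernstein's inequality from `L²` to `L^∞`, with the `L²` norm bounded by the Sobolev norm. -/
theorem eLpNorm_proj_top_le {s : ℝ} (hs : 0 ≤ s) (j : ℕ) (f : R2 → ℂ) :
    eLpNorm (D.proj j f) ∞ volume
      ≤ 3 * (2 : ℝ≥0∞) ^ (j : ℝ) * ((2 : ℝ≥0∞) ^ (s - s * j) * sobolevNorm s f) :=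
  (eLpNorm_top_fourierInv_le _).trans <| (D.eLpNorm_freq_one_le j f).trans <| by
    gcongr
    exact D.eLpNorm_freq_two_le hs j f

theorem eLpNorm_proj_top_ne_top (j : ℕ) (f : R2 → ℂ) : eLpNorm (D.proj j f) ∞ volume ≠ ∞ :=
  ne_top_of_le_ne_top
    ((D.continuous_freq j f).memLp_of_hasCompactSupport (p := 1)
      (D.hasCompactSupport_freq j f)).eLpNorm_ne_top
    (eLpNorm_top_fourierInv_le _)

theorem eLpNorm_proj_top_le_holder (σ : ℝ) (j : ℕ) (f : R2 → ℂ) :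
    eLpNorm (D.proj j f) ∞ volume ≤ (2 : ℝ≥0∞) ^ (-(σ * j)) * besovNorm D σ ∞ ∞ f := by
  have h : (2 : ℝ≥0∞) ^ (σ * j) * eLpNorm (D.proj j f) ∞ volume ≤ besovNorm D σ ∞ ∞ f := by
    rw [← ofReal_two_rpow, besovNorm, lqNorm, if_pos rfl]
    exact le_iSup (fun j : ℕ => ENNReal.ofReal ((2 : ℝ) ^ (σ * (j : ℝ)))
      * eLpNorm (D.proj j f) ∞ volume) j
  calc eLpNorm (D.proj j f) ∞ volume
      = (2 : ℝ≥0∞) ^ (-(σ * j)) * ((2 : ℝ≥0∞) ^ (σ * j) * eLpNorm (D.proj j f) ∞ volume) := by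
        rw [← mul_assoc, ← ENNReal.rpow_add _ _ (by norm_num) (by norm_num), neg_add_cancel,
          ENNReal.rpow_zero, one_mul]
    _ ≤ _ := by gcongr

end LPBump

/-- Interpolation of a single Littlewood–Paley piece between `H^s` and `C^σ`. -/
theorem LPBump.piece_le (D : LPBump) {s σ p : ℝ} (hs : 0 ≤ s) (hp : 4 < p) (j : ℕ)
    (f : R2 → ℂ) :
    (2 : ℝ≥0∞) ^ (1 / 2 * (j : ℝ)) * eLpNorm (D.proj j f) (ENNReal.ofReal p) volume
      ≤ (3 * (2 : ℝ≥0∞) ^ s) ^ (1 / 2 : ℝ)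
        * (sobolevNorm s f ^ (1 / 2 : ℝ) * besovNorm D σ ∞ ∞ f ^ (1 / 2 : ℝ))
        * ((2 : ℝ≥0∞) ^ (1 - 2 / p - (s + σ) / 2)) ^ (j : ℝ) := by
  set A := sobolevNorm s f
  set B := besovNorm D σ ∞ ∞ f
  set L : ℝ≥0∞ := 3 * (2 : ℝ≥0∞) ^ s
  have two_add : ∀ y z : ℝ, (2 : ℝ≥0∞) ^ (y + z) = 2 ^ y * 2 ^ z := fun y z =>
    ENNReal.rpow_add y z (by norm_num) (by norm_num)
  have hp0 : 0 < p := by linarith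
  have hx : 0 ≤ 2 / p := by positivity
  have hθ : 0 ≤ 1 / 2 - 2 / p := by
    rw [sub_nonneg, div_le_div_iff₀ hp0 (by norm_num)]
    linarith
  have h2 : eLpNorm (D.proj j f) 2 volume ≤ L * A * 2 ^ (-(s * j)) := by
    calc _ ≤ (2 : ℝ≥0∞) ^ (s - s * j) * A := D.eLpNorm_proj_two_le hs j f
      _ = 1 * (2 : ℝ≥0∞) ^ s * A * 2 ^ (-(s * j)) := by
          rw [sub_eq_add_neg, two_add]
          ring
      _ ≤ _ := by
          gcongr
          change 1 * _ ≤ 3 * _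
          gcongr
          norm_num
  have htop : eLpNorm (D.proj j f) ∞ volume ≤ L * A * 2 ^ ((1 - s) * j) := by
    refine (D.eLpNorm_proj_top_le hs j f).trans (le_of_eq ?_)
    rw [sub_eq_add_neg, two_add, show (1 - s) * (j : ℝ) = j + -(s * j) by ring, two_add]
    ring
  have hhol := D.eLpNorm_proj_top_le_holder σ j f
  calc _ ≤ (2 : ℝ≥0∞) ^ (1 / 2 * (j : ℝ)) * (eLpNorm (D.proj j f) 2 volume ^ (2 / p)
          * eLpNorm (D.proj j f) ∞ volume ^ (1 - 2 / p)) := by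
        gcongr
        exact eLpNorm_le_two_top (by linarith) (D.eLpNorm_proj_top_ne_top j f)
    _ = (2 : ℝ≥0∞) ^ (1 / 2 * (j : ℝ)) * (eLpNorm (D.proj j f) 2 volume ^ (2 / p)
          * (eLpNorm (D.proj j f) ∞ volume ^ (1 / 2 : ℝ)
            * eLpNorm (D.proj j f) ∞ volume ^ (1 / 2 - 2 / p))) := by
        rw [← ENNReal.rpow_add_of_nonneg _ _ (by norm_num) hθ]
        congr 4
        ring
    _ ≤ (2 : ℝ≥0∞) ^ (1 / 2 * (j : ℝ)) * ((L * A * 2 ^ (-(s * j))) ^ (2 / p)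
          * (((2 : ℝ≥0∞) ^ (-(σ * j)) * B) ^ (1 / 2 : ℝ)
            * (L * A * 2 ^ ((1 - s) * j)) ^ (1 / 2 - 2 / p))) := by
        gcongr
    _ = ((L * A) ^ (2 / p) * (L * A) ^ (1 / 2 - 2 / p)) * B ^ (1 / 2 : ℝ)
          * ((2 : ℝ≥0∞) ^ (1 / 2 * (j : ℝ)) * 2 ^ (-(s * j) * (2 / p))
            * 2 ^ (-(σ * j) * (1 / 2)) * 2 ^ ((1 - s) * j * (1 / 2 - 2 / p))) := by
        rw [ENNReal.mul_rpow_of_nonneg _ _ hx, ENNReal.mul_rpow_of_nonneg _ _ hθ,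
          ENNReal.mul_rpow_of_nonneg _ _ (by norm_num : (0 : ℝ) ≤ 1 / 2),
          ← ENNReal.rpow_mul, ← ENNReal.rpow_mul, ← ENNReal.rpow_mul]
        ring
    _ = _ := by
        rw [← ENNReal.rpow_add_of_nonneg _ _ hx hθ, ← two_add, ← two_add, ← two_add,
          ← ENNReal.rpow_mul, show 2 / p + (1 / 2 - 2 / p) = 1 / 2 by ring,
          ENNReal.mul_rpow_of_nonneg _ _ (by norm_num : (0 : ℝ) ≤ 1 / 2), mul_assoc (L ^ _)]
        congr 2
        ring

/-- The interpolation inequality `‖f‖_{B^{1/2}_{p,2}} ≲ (‖f‖_{H^s} ‖f‖_{C^σ})^{1/2}`. -/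
theorem besovNorm_le_sqrt_mul_sqrt (D : LPBump) {s σ p : ℝ} (hs : 0 ≤ s) (hp : 4 < p)
    (hδ : 1 - 2 / p < (s + σ) / 2) :
    ∃ K : ℝ≥0, ∀ f : R2 → ℂ, besovNorm D (1 / 2) (ENNReal.ofReal p) 2 f
      ≤ K * (sobolevNorm s f ^ (1 / 2 : ℝ) * besovNorm D σ ∞ ∞ f ^ (1 / 2 : ℝ)) := by
  set r : ℝ≥0∞ := (2 : ℝ≥0∞) ^ (1 - 2 / p - (s + σ) / 2) with hr
  set L : ℝ≥0∞ := (3 * (2 : ℝ≥0∞) ^ s) ^ (1 / 2 : ℝ) with hL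
  have hr1 : r ^ (2 : ℝ) < 1 := by
    refine ENNReal.rpow_lt_one ?_ (by norm_num)
    rw [hr]
    exact ENNReal.rpow_lt_one_of_one_lt_of_neg (by norm_num) (by linarith)
  have hLtop : L ≠ ∞ := by
    refine ENNReal.rpow_ne_top_of_nonneg (by norm_num) (ENNReal.mul_ne_top (by norm_num) ?_)
    exact ENNReal.rpow_ne_top_of_nonneg hs (by norm_num)
  have hK : L * ((1 - r ^ (2 : ℝ))⁻¹) ^ (1 / 2 : ℝ) ≠ ∞ := by
    refine ENNReal.mul_ne_top hLtop (ENNReal.rpow_ne_top_of_nonneg (by norm_num) ?_)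
    exact ENNReal.inv_ne_top.2 (tsub_pos_of_lt hr1).ne'
  refine ⟨(L * ((1 - r ^ (2 : ℝ))⁻¹) ^ (1 / 2 : ℝ)).toNNReal, fun f => ?_⟩
  rw [ENNReal.coe_toNNReal hK]
  set M := sobolevNorm s f ^ (1 / 2 : ℝ) * besovNorm D σ ∞ ∞ f ^ (1 / 2 : ℝ)
  rw [besovNorm, lqNorm, if_neg (by norm_num), ENNReal.toReal_ofNat]
  calc _ ≤ (∑' j : ℕ, (L * M) ^ (2 : ℝ) * (r ^ (2 : ℝ)) ^ j) ^ (1 / 2 : ℝ) := by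
        refine ENNReal.rpow_le_rpow (ENNReal.tsum_le_tsum fun j => ?_) (by norm_num)
        rw [ofReal_two_rpow]
        refine (ENNReal.rpow_le_rpow (D.piece_le (σ := σ) hs hp j f) (by norm_num)).trans
          (le_of_eq ?_)
        rw [ENNReal.mul_rpow_of_nonneg _ _ (by norm_num), ← ENNReal.rpow_mul, mul_comm (j : ℝ),
          ENNReal.rpow_mul, ENNReal.rpow_natCast]
    _ = _ := by
        rw [ENNReal.tsum_mul_left, ENNReal.tsum_geometric,
          ENNReal.mul_rpow_of_nonneg _ _ (by norm_num), ← ENNReal.rpow_mul]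
        norm_num
        ring

/-- Hölder's inequality in time for `N ≤ K (A B)^{1/2}`, with `A ∈ L^∞` and `B ∈ L²`. -/
theorem lpTimeNorm_four_le {T : ℝ} {K : ℝ≥0} {N A B : ℝ → ℝ≥0∞}
    (h : ∀ t, N t ≤ K * (A t ^ (1 / 2 : ℝ) * B t ^ (1 / 2 : ℝ))) :
    lpTimeNorm 4 T N ≤ (K + 1 : ℝ≥0) * (lpTimeNorm ∞ T A + lpTimeNorm 2 T B) := by
  set a := lpTimeNorm ∞ T A with ha
  set b := lpTimeNorm 2 T B with hb
  rcases eq_or_ne a ∞ with htop | htop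
  · rw [htop, top_add, ENNReal.mul_top (by simp)]
    exact le_top
  have hA : ∀ᵐ t ∂volume.restrict (Ioo (0 : ℝ) T), A t ≤ a := by
    rw [ha, lpTimeNorm, if_pos rfl]
    exact ENNReal.ae_le_essSup A
  have hb' : b = (∫⁻ t in Ioo (0 : ℝ) T, B t ^ (2 : ℝ)) ^ (1 / 2 : ℝ) := by
    rw [hb, lpTimeNorm, if_neg (by norm_num), ENNReal.toReal_ofNat]
  rw [lpTimeNorm, if_neg (by norm_num), ENNReal.toReal_ofNat]
  have hpt : ∀ x : ℝ≥0∞, (x ^ (1 / 2 : ℝ)) ^ (4 : ℝ) = x ^ (2 : ℝ) := fun x => by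
    rw [← ENNReal.rpow_mul]
    norm_num
  calc (∫⁻ t in Ioo (0 : ℝ) T, N t ^ (4 : ℝ)) ^ (1 / (4 : ℝ))
      ≤ (∫⁻ t in Ioo (0 : ℝ) T, ((K : ℝ≥0∞) ^ (4 : ℝ) * a ^ (2 : ℝ)) * B t ^ (2 : ℝ))
          ^ (1 / (4 : ℝ)) := by
        refine ENNReal.rpow_le_rpow (lintegral_mono_ae (hA.mono fun t ht => ?_)) (by norm_num)
        refine (ENNReal.rpow_le_rpow (h t) (by norm_num)).trans ?_
        rw [ENNReal.mul_rpow_of_nonneg _ _ (by norm_num),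
          ENNReal.mul_rpow_of_nonneg _ _ (by norm_num), hpt, hpt, mul_assoc]
        gcongr
    _ = K * (a ^ (1 / 2 : ℝ) * b ^ (1 / 2 : ℝ)) := by
        have hc : (K : ℝ≥0∞) ^ (4 : ℝ) * a ^ (2 : ℝ) ≠ ∞ :=
          ENNReal.mul_ne_top (ENNReal.rpow_ne_top_of_nonneg (by norm_num) ENNReal.coe_ne_top)
            (ENNReal.rpow_ne_top_of_nonneg (by norm_num) htop)
        rw [lintegral_const_mul' _ _ hc, ENNReal.mul_rpow_of_nonneg _ _ (by norm_num),
          ENNReal.mul_rpow_of_nonneg _ _ (by norm_num), hb', ← ENNReal.rpow_mul,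
          ← ENNReal.rpow_mul, ← ENNReal.rpow_mul]
        norm_num [mul_assoc]
    _ ≤ K * ((a + b) ^ (1 / 2 : ℝ) * (a + b) ^ (1 / 2 : ℝ)) := by
        gcongr
        · exact le_self_add
        · exact le_add_self
    _ = K * (a + b) := by
        rw [← ENNReal.rpow_add_of_nonneg _ _ (by norm_num) (by norm_num)]
        norm_num
    _ ≤ _ := by
        gcongr
        exact_mod_cast le_self_add

/-- for `s > 3/4` close to `3/4`, `σ > 1/4` and sufficiently small `ε > 0`, the
continuous embedding `L^∞(0,T;H^s(ℝ²)) ∩ L²(0,T;C^σ(ℝ²)) ↪ L⁴(0,T;B^{1/2}_{4+ε,2}(ℝ²))` holds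
(with `C^σ = B^σ_{∞,∞}`). -/
theorem embedding_L4_Besov (D : LPBump) :
    ∃ s₀ > (3 : ℝ) / 4, ∀ s : ℝ, 3 / 4 < s → s < s₀ →
    ∀ σ : ℝ, 1 / 4 < σ → ∀ T : ℝ, 0 < T →
    ∃ ε₀ > (0 : ℝ), ∀ ε : ℝ, 0 < ε → ε < ε₀ →
    ∃ C : ℝ≥0, ∀ u : ℝ → R2 → ℂ,
      lpTimeNorm 4 T (fun t => besovNorm D (1 / 2) (ENNReal.ofReal (4 + ε)) 2 (u t))
        ≤ (C : ℝ≥0∞) * (lpTimeNorm ∞ T (fun t => sobolevNorm s (u t))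
            + lpTimeNorm 2 T (fun t => besovNorm D σ ∞ ∞ (u t))) := by
  refine ⟨1, by norm_num, fun s hs _ σ hσ T _ => ⟨4 * (s + σ - 1), by linarith,
    fun ε hε hε' => ?_⟩⟩
  have hδ : 1 - 2 / (4 + ε) < (s + σ) / 2 := by
    have h : 1 - 2 / (4 + ε) ≤ 1 / 2 + ε / 8 := by
      rw [sub_le_iff_le_add, ← sub_le_iff_le_add', le_div_iff₀ (by linarith)]
      nlinarith
    linarith
  obtain ⟨K, hK⟩ := besovNorm_le_sqrt_mul_sqrt D (by linarith : 0 ≤ s)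
    (by linarith : 4 < 4 + ε) hδ
  exact ⟨K + 1, fun u => lpTimeNorm_four_le fun t => hK (u t)⟩
end
end

section
/- Let z : ℝ² → ℂ be smooth and define for j = 1, 2 the operators ∇_j = ∂_{x_j} − 2 z̄ (∂_{x_j} z)/(1+|z|²) acting on smooth complex-valued functions, and set b_j = (∂_{x_j} z)/(1+|z|²). Then the commutator satisfies [∇_j, ∇_k] w = −4i Im( b̄_j b_k ) w for all smooth w : ℝ² → ℂ and j, k ∈ {1,2}. -/
noncomputable section

open MeasureTheory Complex Real Filter Set
open scoped ENNReal NNReal FourierTransform ComplexConjugate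

/-- The pull-back covariant derivative `∇_j w = ∂_{x_j} w - 2 z̄ (∂_{x_j} z)/(1+|z|²) · w`. -/
def nabla (z : R2 → ℂ) (j : Fin 2) (w : R2 → ℂ) (x : R2) : ℂ :=
  pd j w x - 2 * conj (z x) * pd j z x / ((1 + Complex.normSq (z x) : ℝ) : ℂ) * w x

/-- `b_j = (∂_{x_j} z)/(1+|z|²)`. -/
def bcoef (z : R2 → ℂ) (j : Fin 2) (x : R2) : ℂ :=
  pd j z x / ((1 + Complex.normSq (z x) : ℝ) : ℂ)

theorem contDiff_pd {E : Type*} [NormedAddCommGroup E] [NormedSpace ℝ E] {f : R2 → E}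
    (hf : ContDiff ℝ (⊤ : ℕ∞) f) (i : Fin 2) : ContDiff ℝ (⊤ : ℕ∞) (pd i f) :=
  (hf.fderiv_right (m := (⊤ : ℕ∞)) (by simp)).clm_apply contDiff_const

theorem pd_comm {E : Type*} [NormedAddCommGroup E] [NormedSpace ℝ E] {f : R2 → E}
    (hf : ContDiff ℝ (⊤ : ℕ∞) f) (j k : Fin 2) (x : R2) :
    pd j (pd k f) x = pd k (pd j f) x := by
  have hd : DifferentiableAt ℝ (fderiv ℝ f) x :=
    (hf.fderiv_right (m := (⊤ : ℕ∞)) (by simp)).differentiable (by simp) x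
  have hpd : ∀ a b : Fin 2, pd a (pd b f) x =
      fderiv ℝ (fderiv ℝ f) x (EuclideanSpace.single a 1) (EuclideanSpace.single b 1) := by
    intro a b
    change fderiv ℝ (fun y => fderiv ℝ f y (EuclideanSpace.single b 1)) x _ = _
    rw [fderiv_clm_apply hd (differentiableAt_const _)]
    simp
  rw [hpd, hpd]
  exact (hf.contDiffAt.isSymmSndFDerivAt (by
    rw [minSmoothness_of_isRCLikeNormedField]
    exact WithTop.coe_le_coe.2 (le_top : (2 : ℕ∞) ≤ ⊤))) _ _

theorem pd_mul {f g : R2 → ℂ} {x : R2} (hf : DifferentiableAt ℝ f x)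
    (hg : DifferentiableAt ℝ g x) (i : Fin 2) :
    pd i (fun y => f y * g y) x = pd i f x * g x + f x * pd i g x := by
  simp only [pd, fderiv_fun_mul hf hg, add_apply,
    smul_apply, smul_eq_mul]
  ring

theorem pd_conj (f : R2 → ℂ) (i : Fin 2) (x : R2) :
    pd i (fun y => conj (f y)) x = conj (pd i f x) := by
  change fderiv ℝ (fun y => star (f y)) x _ = _
  rw [fderiv_star]
  rfl

theorem pd_inv {f : R2 → ℂ} {x : R2} (hf : DifferentiableAt ℝ f x) (h0 : f x ≠ 0) (i : Fin 2) :
    pd i (fun y => (f y)⁻¹) x = -pd i f x / f x ^ 2 := by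
  have h : fderiv ℝ (fun y => (f y)⁻¹) x = _ :=
    ((hasFDerivAt_inv' (𝕜 := ℝ) h0).comp x hf.hasFDerivAt).fderiv
  simp only [pd, h]
  simp
  field_simp

/-- Commutator of the operators `∂_j - a_j` and `∂_k - a_k`. -/
theorem commutator_pd_sub_mul {a b w : R2 → ℂ} (ha : Differentiable ℝ a)
    (hb : Differentiable ℝ b) (hw : ContDiff ℝ (⊤ : ℕ∞) w) (j k : Fin 2) (x : R2) :
    (pd j (fun y => pd k w y - b y * w y) x - a x * (pd k w x - b x * w x))
      - (pd k (fun y => pd j w y - a y * w y) x - b x * (pd j w x - a x * w x))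
      = (pd k a x - pd j b x) * w x := by
  have hwd : Differentiable ℝ w := hw.differentiable (by simp)
  have hpd : ∀ i, Differentiable ℝ (pd i w) := fun i => (contDiff_pd hw i).differentiable (by simp)
  have hexp : ∀ (i l : Fin 2) (c : R2 → ℂ), Differentiable ℝ c →
      pd i (fun y => pd l w y - c y * w y) x
        = pd i (pd l w) x - (pd i c x * w x + c x * pd i w x) := by
    intro i l c hc
    rw [← pd_mul (hc x) (hwd x)]
    rw [pd, fderiv_fun_sub (hpd l x) ((hc x).fun_mul (hwd x))]
    rfl
  rw [hexp j k b hb, hexp k j a ha, pd_comm hw j k]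
  ring

theorem ofReal_one_add_normSq (a : ℂ) :
    ((1 + Complex.normSq a : ℝ) : ℂ) = 1 + a * conj a := by
  rw [Complex.mul_conj]
  push_cast
  rfl

theorem one_add_mul_conj_ne_zero (a : ℂ) : 1 + a * conj a ≠ 0 := by
  rw [← ofReal_one_add_normSq, Complex.ofReal_ne_zero]
  exact (add_pos_of_pos_of_nonneg one_pos (Complex.normSq_nonneg a)).ne'

theorem differentiable_connection {z : R2 → ℂ} (hz : ContDiff ℝ (⊤ : ℕ∞) z) (l : Fin 2) :
    Differentiable ℝ
      (fun y => 2 * conj (z y) * pd l z y / ((1 + Complex.normSq (z y) : ℝ) : ℂ)) := by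
  have hzd : Differentiable ℝ z := hz.differentiable (by simp)
  have hc : Differentiable ℝ (fun y => conj (z y)) := hzd.star
  have hp : Differentiable ℝ (pd l z) := (contDiff_pd hz l).differentiable (by simp)
  simp only [ofReal_one_add_normSq, div_eq_mul_inv]
  exact ((hc.const_mul 2).fun_mul hp).fun_mul
    (((hzd.fun_mul hc).const_add 1).fun_inv fun y => one_add_mul_conj_ne_zero (z y))

theorem pd_connection {z : R2 → ℂ} (hz : ContDiff ℝ (⊤ : ℕ∞) z) (i l : Fin 2) (x : R2) :
    pd i (fun y => 2 * conj (z y) * pd l z y / ((1 + Complex.normSq (z y) : ℝ) : ℂ)) x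
      = 2 * (conj (pd i z x) * pd l z x + conj (z x) * pd i (pd l z) x) / (1 + z x * conj (z x))
        - 2 * conj (z x) * pd l z x * (pd i z x * conj (z x) + z x * conj (pd i z x))
          / (1 + z x * conj (z x)) ^ 2 := by
  have hzd : Differentiable ℝ z := hz.differentiable (by simp)
  have hc : Differentiable ℝ (fun y => conj (z y)) := hzd.star
  have hp : Differentiable ℝ (pd l z) := (contDiff_pd hz l).differentiable (by simp)
  have hq : Differentiable ℝ (fun y => 1 + z y * conj (z y)) := (hzd.mul hc).const_add 1
  have h0 := one_add_mul_conj_ne_zero (z x)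
  have hq' : pd i (fun y => 1 + z y * conj (z y)) x
      = pd i z x * conj (z x) + z x * conj (pd i z x) := by
    rw [← pd_conj, ← pd_mul (hzd x) (hc x)]
    simp only [pd, fderiv_const_add]
  have hn : pd i (fun y => 2 * conj (z y)) x = 2 * conj (pd i z x) := by
    rw [← pd_conj]
    simp only [pd, fderiv_const_mul (hc x)]
    rfl
  simp only [ofReal_one_add_normSq, div_eq_mul_inv]
  rw [pd_mul (((hc.const_mul 2).fun_mul hp) x) ((hq x).fun_inv h0),
    pd_mul ((hc.const_mul 2) x) (hp x), pd_inv (hq x) h0, hq', hn]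
  ring

/-- the commutator identity `[∇_j, ∇_k] w = -4i Im(b̄_j b_k) w`. -/
theorem covariant_commutator (z : R2 → ℂ) (hz : ContDiff ℝ (⊤ : ℕ∞) z)
    (w : R2 → ℂ) (hw : ContDiff ℝ (⊤ : ℕ∞) w) (j k : Fin 2) (x : R2) :
    nabla z j (nabla z k w) x - nabla z k (nabla z j w) x
      = (-4 : ℂ) * I * ((conj (bcoef z j x) * bcoef z k x).im : ℂ) * w x := by
  have h := commutator_pd_sub_mul (differentiable_connection hz j)
    (differentiable_connection hz k) hw j k x
  refine h.trans ?_
  have h0 := one_add_mul_conj_ne_zero (z x)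
  have him : ∀ c : ℂ, (-4 : ℂ) * I * (c.im : ℂ) = -2 * (c - conj c) := by
    intro c
    rw [Complex.sub_conj]
    push_cast
    ring
  have hself : conj (1 + z x * conj (z x)) = 1 + z x * conj (z x) := by
    simp [mul_comm]
  rw [pd_connection hz, pd_connection hz, pd_comm hz k j, him]
  simp only [bcoef, ofReal_one_add_normSq, map_mul, map_div₀, Complex.conj_conj, hself]
  field_simp
  ring
end
end
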